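/- Let Y be a Banach space over 𝕂 = ℝ or ℂ that contains no subspace isomorphic to c₀ (in particular, this holds if Y has the Radon–Nikodým property). Then BS(c₀;Y) = {0}, i.e., the zero operator is the only operator from c₀ to Y with the Bhatia–Šemrl property. -/

import Mathlib

noncomputable section

/-- `x` is Birkhoff--James orthogonal to `y`: `‖x‖ ≤ ‖x + a • y‖` for every scalar `a`. -/
def BJOrth (𝕂 : Type*) [RCLike 𝕂] {E : Type*} [NormedAddCommGroup E] [NormedSpace 𝕂 E]
    (x y : E) : Prop :=
  ∀ a : 𝕂, ‖x‖ ≤ ‖x + a • y‖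

/-- The Bhatia--Šemrl property for bounded linear operators: whenever `T ⊥_B S` there is a
norm attaining point `x` of `T` with `T x ⊥_B S x`. -/
def HasBSProp (𝕂 : Type*) [RCLike 𝕂] {X Y : Type*} [NormedAddCommGroup X] [NormedSpace 𝕂 X]
    [NormedAddCommGroup Y] [NormedSpace 𝕂 Y] (T : X →L[𝕂] Y) : Prop :=
  ∀ S : X →L[𝕂] Y, BJOrth 𝕂 T S →
    ∃ x : X, ‖x‖ = 1 ∧ ‖T x‖ = ‖T‖ ∧ BJOrth 𝕂 (T x) (S x)

section

open scoped ZeroAtInfty Topology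
open Filter

variable {𝕂 : Type*} [RCLike 𝕂]

/-- A null sequence as an element of `C₀(ℕ, 𝕂)`. -/
def c0OfTendsto (f : ℕ → 𝕂) (hf : Tendsto f cofinite (𝓝 0)) : C₀(ℕ, 𝕂) where
  toFun := f
  continuous_toFun := continuous_of_discreteTopology
  zero_at_infty' := by rwa [cocompact_eq_cofinite]

/-- The `n`-th unit vector of `c₀`. -/
def c0Basis (𝕂 : Type*) [RCLike 𝕂] (n : ℕ) : C₀(ℕ, 𝕂) :=
  c0OfTendsto (Pi.single n 1) (tendsto_nhds_of_eventually_eq <| by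
    filter_upwards [(Set.finite_singleton n).compl_mem_cofinite] with m hm
    exact Pi.single_eq_of_ne (by simpa using hm) 1)

@[simp] lemma c0OfTendsto_apply (f : ℕ → 𝕂) (hf : Tendsto f cofinite (𝓝 0)) (n : ℕ) :
    c0OfTendsto f hf n = f n := rfl

lemma c0Basis_apply (n m : ℕ) : c0Basis 𝕂 n m = if m = n then 1 else 0 :=
  Pi.single_apply n 1 m

lemma c0_tendsto (x : C₀(ℕ, 𝕂)) : Tendsto x cofinite (𝓝 0) := by
  have := x.zero_at_infty'
  rwa [cocompact_eq_cofinite] at this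

lemma c0_norm_apply_le (x : C₀(ℕ, 𝕂)) (n : ℕ) : ‖x n‖ ≤ ‖x‖ := by
  rw [← ZeroAtInftyContinuousMap.norm_toBCF_eq_norm]
  exact x.toBCF.norm_coe_le_norm n

lemma c0_norm_le {x : C₀(ℕ, 𝕂)} {C : ℝ} (hC : 0 ≤ C) (h : ∀ n, ‖x n‖ ≤ C) : ‖x‖ ≤ C := by
  rw [← ZeroAtInftyContinuousMap.norm_toBCF_eq_norm]
  exact (BoundedContinuousFunction.norm_le hC).2 h

lemma c0_sum_apply {ι : Type*} (F : Finset ι) (v : ι → C₀(ℕ, 𝕂)) (n : ℕ) :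
    (∑ i ∈ F, v i) n = ∑ i ∈ F, v i n := by
  classical
  induction F using Finset.induction_on with
  | empty => simp
  | insert i F hi ih => simp [Finset.sum_insert hi, ih]

lemma c0_sum_smul_basis_apply (F : Finset ℕ) (c : ℕ → 𝕂) (n : ℕ) :
    (∑ j ∈ F, c j • c0Basis 𝕂 j) n = if n ∈ F then c n else 0 := by
  simp [c0_sum_apply, c0Basis_apply]

lemma c0_norm_sum_smul_basis_le (F : Finset ℕ) {c : ℕ → 𝕂} {C : ℝ} (hC : 0 ≤ C)
    (h : ∀ j ∈ F, ‖c j‖ ≤ C) : ‖∑ j ∈ F, c j • c0Basis 𝕂 j‖ ≤ C := by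
  refine c0_norm_le hC fun n => ?_
  rw [c0_sum_smul_basis_apply]
  split_ifs with hn
  · exact h n hn
  · simpa using hC

lemma c0_hasSum (x : C₀(ℕ, 𝕂)) : HasSum (fun j => x j • c0Basis 𝕂 j) x := by
  rw [HasSum, SummationFilter.unconditional_filter, Metric.tendsto_nhds]
  intro ε hε
  have hfin : {n | ¬ ‖x n‖ < ε / 2}.Finite := by
    have := (c0_tendsto x).norm.eventually_lt_const (u := ε / 2) (by simpa using hε)
    simpa using this
  filter_upwards [eventually_ge_atTop hfin.toFinset] with F hF
  rw [dist_eq_norm]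
  refine lt_of_le_of_lt (c0_norm_le (half_pos hε).le fun n => ?_) (half_lt_self hε)
  rw [ZeroAtInftyContinuousMap.sub_apply, c0_sum_smul_basis_apply]
  split_ifs with hn
  · simpa using (half_pos hε).le
  · by_contra! h
    exact hn (hF (by simpa using (by simpa using h.le : ε / 2 ≤ ‖x n‖)))

/-- Evaluation at `n` as a functional on `c₀`. -/
def c0Eval (𝕂 : Type*) [RCLike 𝕂] (n : ℕ) : C₀(ℕ, 𝕂) →L[𝕂] 𝕂 :=
  LinearMap.mkContinuous
    { toFun := fun x => x n, map_add' := fun _ _ => rfl, map_smul' := fun _ _ => rfl } 1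
    fun x => by simpa using c0_norm_apply_le x n

@[simp] lemma c0Eval_apply (n : ℕ) (x : C₀(ℕ, 𝕂)) : c0Eval 𝕂 n x = x n := rfl

lemma norm_c0Eval_le (n : ℕ) : ‖c0Eval 𝕂 n‖ ≤ 1 :=
  LinearMap.mkContinuous_norm_le _ zero_le_one _

lemma tendsto_extend_zero {φ : ℕ → ℕ} (hφ : φ.Injective) {f : ℕ → 𝕂}
    (hf : Tendsto f cofinite (𝓝 0)) :
    Tendsto (Function.extend φ f 0) cofinite (𝓝 0) := by
  intro s hs
  have h0 : (0 : 𝕂) ∈ s := mem_of_mem_nhds hs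
  have hfin : (f ⁻¹' s)ᶜ.Finite := hf hs
  refine (hfin.image φ).subset fun n hn => ?_
  by_cases h : ∃ k, φ k = n
  · obtain ⟨k, rfl⟩ := h
    refine ⟨k, ?_, rfl⟩
    simpa [hφ.extend_apply] using hn
  · exact absurd (by simpa [Function.extend_apply' _ _ _ h] using h0) hn

/-- The embedding of `c₀` into itself which sends the `n`-th unit vector to the `φ n`-th one. -/
def c0Spread (𝕂 : Type*) [RCLike 𝕂] (φ : ℕ → ℕ) (hφ : φ.Injective) :
    C₀(ℕ, 𝕂) →L[𝕂] C₀(ℕ, 𝕂) :=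
  LinearMap.mkContinuous
    { toFun := fun x => c0OfTendsto (Function.extend φ x 0)
        (tendsto_extend_zero hφ (c0_tendsto x))
      map_add' := fun x y => by
        ext n
        simpa using congrFun (Function.extend_add φ x y 0 0) n
      map_smul' := fun c x => by
        ext n
        simpa using congrFun (Function.extend_smul c φ x 0) n } 1
    fun x => by
      rw [one_mul]
      refine c0_norm_le (norm_nonneg x) fun n => ?_
      change ‖Function.extend φ x 0 n‖ ≤ ‖x‖
      by_cases h : ∃ k, φ k = n
      · obtain ⟨k, rfl⟩ := h
        rw [hφ.extend_apply]
        exact c0_norm_apply_le x k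
      · simp [Function.extend_apply' _ _ _ h]

lemma c0Spread_basis {φ : ℕ → ℕ} (hφ : φ.Injective) (k : ℕ) :
    c0Spread 𝕂 φ hφ (c0Basis 𝕂 k) = c0Basis 𝕂 (φ k) := by
  ext n
  change Function.extend φ (c0Basis 𝕂 k) 0 n = _
  by_cases h : ∃ j, φ j = n
  · obtain ⟨j, rfl⟩ := h
    simp [hφ.extend_apply, c0Basis_apply, hφ.eq_iff]
  · rw [Function.extend_apply' _ _ _ h, c0Basis_apply, if_neg fun e => h ⟨k, e.symm⟩]
    rfl

lemma sum_norm_apply_basis_le (h : C₀(ℕ, 𝕂) →L[𝕂] 𝕂) (F : Finset ℕ) :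
    ∑ j ∈ F, ‖h (c0Basis 𝕂 j)‖ ≤ ‖h‖ := by
  have hc : ∀ j, ∃ c : 𝕂, ‖c‖ = 1 ∧ c * h (c0Basis 𝕂 j) = ‖h (c0Basis 𝕂 j)‖ := fun j =>
    (RCLike.exists_norm_eq_mul_self _).imp fun c hc => ⟨hc.1, hc.2.symm⟩
  choose c hc1 hc2 using hc
  have h1 : h (∑ j ∈ F, c j • c0Basis 𝕂 j) = ((∑ j ∈ F, ‖h (c0Basis 𝕂 j)‖ : ℝ) : 𝕂) := by
    simp [hc2]
  have h2 := h.le_opNorm_of_le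
    (c0_norm_sum_smul_basis_le F zero_le_one fun j _ => (hc1 j).le)
  rw [h1, RCLike.norm_ofReal, mul_one] at h2
  exact (le_abs_self _).trans h2

lemma norm_apply_sub_le (h : C₀(ℕ, 𝕂) →L[𝕂] 𝕂) {k : ℕ} {C : ℝ}
    (hC : ∀ F : Finset ℕ, k ∉ F → ∑ j ∈ F, ‖h (c0Basis 𝕂 j)‖ ≤ C) (x : C₀(ℕ, 𝕂)) :
    ‖h x - x k * h (c0Basis 𝕂 k)‖ ≤ C * ‖x‖ := by
  have hs : HasSum (fun j => x j * h (c0Basis 𝕂 j)) (h x) := by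
    simpa using h.hasSum (c0_hasSum x)
  have ht : Tendsto (fun F : Finset ℕ => ∑ j ∈ F, x j * h (c0Basis 𝕂 j)) atTop (𝓝 (h x)) := hs
  refine le_of_tendsto (ht.sub_const _).norm ?_
  filter_upwards [eventually_ge_atTop {k}] with F hF
  have hk : k ∈ F := hF (Finset.mem_singleton_self k)
  rw [← Finset.sum_erase_eq_sub hk, mul_comm C]
  calc ‖∑ j ∈ F.erase k, x j * h (c0Basis 𝕂 j)‖
      ≤ ∑ j ∈ F.erase k, ‖x‖ * ‖h (c0Basis 𝕂 j)‖ := by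
        refine norm_sum_le_of_le _ fun j _ => ?_
        rw [norm_mul]
        gcongr
        exact c0_norm_apply_le x j
    _ = ‖x‖ * ∑ j ∈ F.erase k, ‖h (c0Basis 𝕂 j)‖ := by rw [Finset.mul_sum]
    _ ≤ ‖x‖ * C := by
        gcongr
        exact hC _ (Finset.notMem_erase k F)

/-- Rosenthal's lemma on matrices with bounded rows, with an explicit bound for the
off-diagonal row sums as induction parameter. -/
lemma exists_injective_offDiag_sum_le {ε : ℝ} (N : ℕ) (a : ℕ → ℕ → ℝ)
    (ha : ∀ k, ∀ F : Finset ℕ, k ∉ F → ∑ j ∈ F, a k j ≤ (N + 1) * ε) :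
    ∃ φ : ℕ → ℕ, φ.Injective ∧ ∀ k, ∀ F : Finset ℕ, k ∉ F → ∑ j ∈ F, a (φ k) (φ j) ≤ ε := by
  classical
  induction N generalizing a with
  | zero => exact ⟨id, Function.injective_id, by simpa using ha⟩
  | succ N ih =>
    have hpair : ∀ p, (fun q => Nat.pair p q).Injective := fun p q r h =>
      (Nat.pair_eq_pair.1 h).2
    by_cases hp : ∃ p, ∀ k, ∀ F : Finset ℕ, k ∉ F →
        ∑ j ∈ F, a (Nat.pair p k) (Nat.pair p j) ≤ ε
    · obtain ⟨p, hp⟩ := hp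
      exact ⟨fun q => Nat.pair p q, hpair p, hp⟩
    push Not at hp
    choose q G hqG hG using hp
    have hψ : (fun p => Nat.pair p (q p)).Injective := fun p r h => (Nat.pair_eq_pair.1 h).1
    obtain ⟨φ, hφ, h⟩ := ih (fun k j => a (Nat.pair k (q k)) (Nat.pair j (q j))) <| by
      intro k F hk
      have hdisj : Disjoint (F.image fun j => Nat.pair j (q j))
          ((G k).image fun j => Nat.pair k j) := by
        rw [Finset.disjoint_left]
        intro m hm hm'
        obtain ⟨j, hj, rfl⟩ := Finset.mem_image.1 hm
        obtain ⟨i, -, hi⟩ := Finset.mem_image.1 hm'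
        exact hk ((Nat.pair_eq_pair.1 hi).1 ▸ hj)
      have hnot : Nat.pair k (q k) ∉ (F.image fun j => Nat.pair j (q j)) ∪
          ((G k).image fun j => Nat.pair k j) := by
        rw [Finset.mem_union, not_or]
        refine ⟨fun hm => ?_, fun hm => ?_⟩
        · obtain ⟨j, hj, hjk⟩ := Finset.mem_image.1 hm
          exact hk ((Nat.pair_eq_pair.1 hjk).1 ▸ hj)
        · obtain ⟨j, hj, hjk⟩ := Finset.mem_image.1 hm
          exact hqG k ((Nat.pair_eq_pair.1 hjk).2 ▸ hj)
      have hsum := ha _ _ hnot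
      rw [Finset.sum_union hdisj, Finset.sum_image hψ.injOn,
        Finset.sum_image (hpair k).injOn] at hsum
      have := hG k
      push_cast at hsum
      linarith
    exact ⟨_, hψ.comp hφ, h⟩

variable {Y : Type*} [NormedAddCommGroup Y] [NormedSpace 𝕂 Y]

/-- An operator on `c₀` which is bounded below on the unit vectors fixes a copy of `c₀`. -/
lemma exists_antilipschitz_of_le_norm_basis (T : C₀(ℕ, 𝕂) →L[𝕂] Y) {δ : ℝ} (hδ : 0 < δ)
    (hT : ∀ n, δ ≤ ‖T (c0Basis 𝕂 n)‖) :
    ∃ f : C₀(ℕ, 𝕂) →L[𝕂] Y, ∃ c : ℝ, 0 < c ∧ ∀ x, c * ‖x‖ ≤ ‖f x‖ := by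
  choose g hg1 hg2 using fun n => exists_dual_vector'' 𝕂 (T (c0Basis 𝕂 n))
  obtain ⟨N, hN⟩ := exists_nat_ge (‖T‖ / (δ / 2))
  rw [div_le_iff₀ (half_pos hδ)] at hN
  obtain ⟨φ, hφ, h⟩ := exists_injective_offDiag_sum_le (ε := δ / 2) N
    (fun n m => ‖g n (T (c0Basis 𝕂 m))‖) fun k F _ => by
      calc ∑ j ∈ F, ‖g k (T (c0Basis 𝕂 j))‖ ≤ ‖(g k).comp T‖ :=
            sum_norm_apply_basis_le ((g k).comp T) F
        _ ≤ ‖g k‖ * ‖T‖ := (g k).opNorm_comp_le T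
        _ ≤ 1 * ‖T‖ := by gcongr; exact hg1 k
        _ ≤ (N + 1) * (δ / 2) := by linarith
  refine ⟨T.comp (c0Spread 𝕂 φ hφ), δ / 2, half_pos hδ, fun x => ?_⟩
  set y := (T.comp (c0Spread 𝕂 φ hφ)) x with hy
  have key : ∀ k, ‖x k‖ ≤ (‖y‖ + δ / 2 * ‖x‖) / δ := fun k => by
    have h1 := norm_apply_sub_le ((g (φ k)).comp (T.comp (c0Spread 𝕂 φ hφ))) (k := k)
      (C := δ / 2) (by simpa [c0Spread_basis] using h k) x
    have h2 : ‖g (φ k) y‖ ≤ ‖y‖ := (g (φ k)).le_of_opNorm_le_of_le (hg1 _) le_rfl |>.trans_eq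
      (one_mul _)
    rw [le_div_iff₀ hδ]
    have h3 : ((g (φ k)).comp (T.comp (c0Spread 𝕂 φ hφ))) (c0Basis 𝕂 k)
        = ‖T (c0Basis 𝕂 (φ k))‖ := by simp [c0Spread_basis, hg2]
    rw [h3] at h1
    have h4 := norm_sub_norm_le (x k * (‖T (c0Basis 𝕂 (φ k))‖ : 𝕂)) (g (φ k) y)
    rw [norm_sub_rev, norm_mul, RCLike.norm_ofReal, abs_norm] at h4
    have h5 := mul_le_mul_of_nonneg_left (hT (φ k)) (norm_nonneg (x k))
    have h6 : ‖g (φ k) y - x k * (‖T (c0Basis 𝕂 (φ k))‖ : 𝕂)‖ ≤ δ / 2 * ‖x‖ := h1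
    linarith
  have := c0_norm_le (by positivity) key
  rw [le_div_iff₀ hδ] at this
  linarith

/-- If `Y` contains no copy of `c₀`, then every operator from `c₀` to `Y` is summable along
some subsequence of the unit vectors. -/
lemma exists_injective_norm_basis_le
    (hY : ¬ ∃ f : C₀(ℕ, 𝕂) →L[𝕂] Y, ∃ c : ℝ, 0 < c ∧ ∀ x, c * ‖x‖ ≤ ‖f x‖)
    (T : C₀(ℕ, 𝕂) →L[𝕂] Y) (N : ℕ) :
    ∃ σ : ℕ → ℕ, StrictMono σ ∧ (∀ j, N ≤ σ j) ∧
      ∀ j, ‖T (c0Basis 𝕂 (σ j))‖ ≤ (1 / 2 : ℝ) ^ j := by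
  have small : ∀ δ > 0, ∀ M, ∃ n ≥ M, ‖T (c0Basis 𝕂 n)‖ < δ := by
    intro δ hδ M
    by_contra! h
    refine hY (exists_antilipschitz_of_le_norm_basis
      (T.comp (c0Spread 𝕂 (M + ·) (add_right_injective M))) hδ fun n => ?_)
    simpa [c0Spread_basis] using h (M + n) (Nat.le_add_right M n)
  obtain ⟨σ, hσ, h⟩ := extraction_forall_of_frequently
    (P := fun j n => N ≤ n ∧ ‖T (c0Basis 𝕂 n)‖ ≤ (1 / 2 : ℝ) ^ j) fun j => by
      rw [frequently_atTop]
      intro M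
      obtain ⟨n, hn, hlt⟩ := small ((1 / 2 : ℝ) ^ j) (by positivity) (max M N)
      exact ⟨n, (le_max_left _ _).trans hn, (le_max_right _ _).trans hn, hlt.le⟩
  exact ⟨σ, hσ, fun j => (h j).1, fun j => (h j).2⟩

/-- An absolutely convergent series of functionals defines a functional. -/
lemma exists_functional_hasSum {E : Type*} [SeminormedAddCommGroup E] [NormedSpace 𝕂 E]
    {e : ℕ → E →L[𝕂] 𝕂} (he : ∀ j, ‖e j‖ ≤ 1) {c : ℕ → ℝ} (hc : Summable c)
    (hc0 : ∀ j, 0 ≤ c j) :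
    ∃ g : E →L[𝕂] 𝕂, ∀ x, HasSum (fun j => (c j : 𝕂) * e j x) (g x) := by
  have hsum : Summable fun j => (c j : 𝕂) • e j := by
    refine Summable.of_norm_bounded hc fun j => ?_
    rw [norm_smul, RCLike.norm_ofReal, abs_of_nonneg (hc0 j)]
    exact mul_le_of_le_one_right (hc0 j) (he j)
  refine ⟨∑' j, (c j : 𝕂) • e j, fun x => ?_⟩
  simpa using hsum.hasSum.mapL (ContinuousLinearMap.apply 𝕂 𝕂 x)

/-- Along an injective sequence of coordinates there is a functional of norm one on `c₀`
which does not attain its norm. -/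
lemma exists_functional_not_norm_attaining {σ : ℕ → ℕ} (hσ : σ.Injective) :
    ∃ g : C₀(ℕ, 𝕂) →L[𝕂] 𝕂, (∀ x, ‖x‖ = 1 → ‖g x‖ < 1) ∧
      (∀ n, n ∉ Set.range σ → g (c0Basis 𝕂 n) = 0) ∧
      HasSum (fun j => g (c0Basis 𝕂 (σ j))) 1 := by
  have hgeo : HasSum (fun j : ℕ => (1 / 2 : ℝ) / 2 ^ j) 1 := hasSum_geometric_two' 1
  obtain ⟨g, hg⟩ := exists_functional_hasSum (𝕂 := 𝕂) (fun j => norm_c0Eval_le (σ j))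
    hgeo.summable fun j => by positivity
  simp only [c0Eval_apply] at hg
  refine ⟨g, fun x hx => ?_, fun n hn => ?_, ?_⟩
  · have hnorm : ∀ j : ℕ, ‖(((1 / 2 : ℝ) / 2 ^ j : ℝ) : 𝕂) * x (σ j)‖
        = (1 / 2 : ℝ) / 2 ^ j * ‖x (σ j)‖ := fun j => by
      rw [norm_mul, RCLike.norm_ofReal, abs_of_nonneg (by positivity)]
    have hle : ∀ j : ℕ, (1 / 2 : ℝ) / 2 ^ j * ‖x (σ j)‖ ≤ (1 / 2 : ℝ) / 2 ^ j := fun j =>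
      mul_le_of_le_one_right (by positivity) (hx ▸ c0_norm_apply_le x _)
    have hsn : Summable fun j : ℕ => (1 / 2 : ℝ) / 2 ^ j * ‖x (σ j)‖ :=
      Summable.of_nonneg_of_le (fun j => by positivity) hle hgeo.summable
    obtain ⟨j, hj⟩ : ∃ j, ‖x (σ j)‖ < 1 := by
      have h0 : Tendsto (fun j => ‖x (σ j)‖) cofinite (𝓝 0) := by
        simpa using ((c0_tendsto x).comp hσ.tendsto_cofinite).norm
      exact (h0.eventually (gt_mem_nhds one_pos)).exists
    calc ‖g x‖ = ‖∑' j : ℕ, (((1 / 2 : ℝ) / 2 ^ j : ℝ) : 𝕂) * x (σ j)‖ := by rw [(hg x).tsum_eq]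
      _ ≤ ∑' j : ℕ, (1 / 2 : ℝ) / 2 ^ j * ‖x (σ j)‖ :=
          tsum_of_norm_bounded hsn.hasSum fun j => (hnorm j).le
      _ < ∑' j : ℕ, (1 / 2 : ℝ) / 2 ^ j :=
          hsn.tsum_lt_tsum (i := j) hle (mul_lt_of_lt_one_right (by positivity) hj) hgeo.summable
      _ = 1 := hgeo.tsum_eq
  · refine (hg _).unique ?_
    convert hasSum_zero with j
    rw [c0Basis_apply, if_neg fun h => hn ⟨j, h⟩, mul_zero]
  · have : ∀ k, g (c0Basis 𝕂 (σ k)) = (((1 / 2 : ℝ) / 2 ^ k : ℝ) : 𝕂) := fun k => by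
      refine (hg _).unique ?_
      convert hasSum_ite_eq k (((1 / 2 : ℝ) / 2 ^ k : ℝ) : 𝕂) with j
      by_cases h : j = k
      · simp [c0Basis_apply, h]
      · simp [c0Basis_apply, hσ.eq_iff, h]
    simp_rw [this]
    simpa only [RCLike.ofReal_one] using (RCLike.hasSum_ofReal 𝕂).2 hgeo

/-- At a norm attaining point `x` of a functional, its coefficients vanish wherever
`‖x n‖ ≤ 1 / 2`. -/
lemma apply_basis_eq_zero_of_norm_attaining {h : C₀(ℕ, 𝕂) →L[𝕂] 𝕂} {x : C₀(ℕ, 𝕂)} {C : ℝ}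
    (hC : ‖h‖ ≤ C) (hx : ‖x‖ = 1) (hhx : h x = C) {n : ℕ} (hn : ‖x n‖ ≤ 1 / 2) :
    h (c0Basis 𝕂 n) = 0 := by
  obtain ⟨c, hc1, hc2⟩ := RCLike.exists_norm_eq_mul_self (h (c0Basis 𝕂 n))
  have hle : ‖x + ((1 / 2 : ℝ) : 𝕂) • c • c0Basis 𝕂 n‖ ≤ 1 := by
    refine c0_norm_le zero_le_one fun m => ?_
    simp only [ZeroAtInftyContinuousMap.add_apply, ZeroAtInftyContinuousMap.smul_apply,
      c0Basis_apply]
    split_ifs with hm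
    · subst hm
      refine (norm_add_le _ _).trans ?_
      rw [smul_eq_mul, smul_eq_mul, mul_one, norm_mul, hc1, RCLike.norm_ofReal,
        abs_of_pos one_half_pos]
      linarith
    · simpa [hx] using c0_norm_apply_le x m
  have h1 := h.le_of_opNorm_le_of_le hC hle
  have h2 : h (x + ((1 / 2 : ℝ) : 𝕂) • c • c0Basis 𝕂 n)
      = ((C + 1 / 2 * ‖h (c0Basis 𝕂 n)‖ : ℝ) : 𝕂) := by
    rw [map_add, map_smul, map_smul, hhx, smul_eq_mul, smul_eq_mul, ← hc2]
    push_cast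
    rfl
  rw [h2, RCLike.norm_ofReal, mul_one] at h1
  have h3 := (le_abs_self _).trans h1
  exact norm_le_zero_iff.1 (by linarith)

lemma not_hasBSProp_of_ne_zero [CompleteSpace Y]
    (hY : ¬ ∃ f : C₀(ℕ, 𝕂) →L[𝕂] Y, ∃ c : ℝ, 0 < c ∧ ∀ x, c * ‖x‖ ≤ ‖f x‖)
    {T : C₀(ℕ, 𝕂) →L[𝕂] Y} (hT : T ≠ 0) : ¬ HasBSProp 𝕂 T := by
  intro hBS
  obtain ⟨x, hx, hTx, -⟩ := hBS 0 fun a => by simp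
  obtain ⟨f, hf1, hf2⟩ := exists_dual_vector'' 𝕂 (T x)
  rw [hTx] at hf2
  have hfT : ‖f.comp T‖ ≤ ‖T‖ := (f.opNorm_comp_le T).trans
    (mul_le_of_le_one_left (norm_nonneg _) hf1)
  obtain ⟨N, hN⟩ : ∃ N, ∀ n ≥ N, ‖x n‖ ≤ 1 / 2 := by
    have h0 : Tendsto (fun n => ‖x n‖) atTop (𝓝 0) := by
      simpa [Nat.cofinite_eq_atTop] using (c0_tendsto x).norm
    exact eventually_atTop.1 (h0.eventually (ge_mem_nhds one_half_pos))
  have hvanish : ∀ n ≥ N, f (T (c0Basis 𝕂 n)) = 0 := fun n hn =>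
    apply_basis_eq_zero_of_norm_attaining (h := f.comp T) hfT hx hf2 (hN n hn)
  obtain ⟨σ, hσ, hσN, hσT⟩ := exists_injective_norm_basis_le hY T N
  obtain ⟨g, hg1, hg0, hgsum⟩ := exists_functional_not_norm_attaining (𝕂 := 𝕂) hσ.injective
  set u := ∑ j ∈ Finset.range N, x j • c0Basis 𝕂 j with hu
  have hfu : f (T u) = ‖T‖ := by
    have h1 : HasSum (fun j => x j * f (T (c0Basis 𝕂 j))) (f (T x)) := by
      simpa using (f.comp T).hasSum (c0_hasSum x)
    have h2 := h1.unique (hasSum_sum_of_ne_finset_zero (s := Finset.range N) fun j hj => by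
      rw [hvanish j (by simpa using hj), mul_zero])
    rw [← hf2, h2]
    simp [hu]
  have hgu : g u = 0 := by
    rw [hu, map_sum]
    refine Finset.sum_eq_zero fun j hj => ?_
    rw [map_smul, hg0, smul_zero]
    rintro ⟨i, rfl⟩
    exact (Finset.mem_range.1 hj).not_ge (hσN i)
  set z : ℕ → C₀(ℕ, 𝕂) := fun k => u + ∑ j ∈ Finset.range k, c0Basis 𝕂 (σ j) with hz
  have hzn : ∀ k, ‖z k‖ ≤ 1 := fun k => by
    refine c0_norm_le zero_le_one fun n => ?_
    rw [hz, ZeroAtInftyContinuousMap.add_apply, hu, c0_sum_smul_basis_apply, c0_sum_apply]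
    simp only [c0Basis_apply]
    by_cases hn : n < N
    · rw [if_pos (Finset.mem_range.2 hn), Finset.sum_eq_zero, add_zero, ← hx]
      · exact c0_norm_apply_le x n
      · intro j _
        exact if_neg (hn.trans_le (hσN j)).ne
    · rw [if_neg (by simpa using hn), zero_add]
      by_cases hr : ∃ i, σ i = n
      · obtain ⟨i, rfl⟩ := hr
        simp only [hσ.injective.eq_iff, Finset.sum_ite_eq]
        split_ifs <;> simp
      · rw [Finset.sum_eq_zero fun j _ => if_neg fun h => hr ⟨j, h.symm⟩]
        simp
  have hfz : ∀ k, f (T (z k)) = ‖T‖ := fun k => by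
    simp [hz, hfu, hvanish _ (hσN _)]
  have hgz : Tendsto (fun k => g (z k)) atTop (𝓝 1) := by
    simpa [hz, hgu] using hgsum.tendsto_sum_nat
  have hTsum : Summable fun j => T (c0Basis 𝕂 (σ j)) :=
    Summable.of_norm_bounded summable_geometric_two hσT
  set y := T u + ∑' j, T (c0Basis 𝕂 (σ j))
  have hTz : Tendsto (fun k => T (z k)) atTop (𝓝 y) := by
    simpa [hz] using hTsum.hasSum.tendsto_sum_nat.const_add (T u)
  have hy : ‖y‖ ≤ ‖T‖ := le_of_tendsto' hTz.norm fun k =>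
    (T.le_opNorm_of_le (hzn k)).trans_eq (mul_one _)
  have hSz : Tendsto (fun k => (T - g.smulRight y) (z k)) atTop (𝓝 0) := by
    simpa using hTz.sub (hgz.smul_const y)
  obtain ⟨w, hw, hTw, horth⟩ := hBS (T - g.smulRight y) fun a => by
    have hlim : Tendsto (fun k => ‖f ((T + a • (T - g.smulRight y)) (z k))‖) atTop
        (𝓝 ‖T‖) := by
      have h1 : Tendsto (fun k => f (T (z k)) + a * f ((T - g.smulRight y) (z k))) atTop
          (𝓝 ((‖T‖ : 𝕂) + a * f 0)) := by
        simp_rw [hfz]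
        exact (((f.continuous.tendsto 0).comp hSz).const_mul a).const_add _
      have h2 := h1.norm
      rw [map_zero, mul_zero, add_zero, RCLike.norm_ofReal,
        abs_of_nonneg (norm_nonneg T)] at h2
      refine h2.congr fun k => ?_
      rw [add_apply, smul_apply, f.map_add, f.map_smul, smul_eq_mul]
    refine le_of_tendsto' hlim fun k => ?_
    refine (f.le_of_opNorm_le_of_le hf1 le_rfl).trans ?_
    rw [one_mul]
    exact (ContinuousLinearMap.le_opNorm_of_le _ (hzn k)).trans_eq (mul_one _)
  have hTpos : 0 < ‖T‖ :=
    (norm_nonneg T).lt_of_ne' fun h => hT (T.opNorm_zero_iff.1 h)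
  have h1 := horth (-1)
  have h2 : T w + (-1 : 𝕂) • (T - g.smulRight y) w = g w • y := by simp
  rw [h2, hTw, norm_smul] at h1
  have h3 : ‖g w‖ * ‖y‖ ≤ ‖g w‖ * ‖T‖ := by gcongr
  exact (h1.trans h3).not_gt (mul_lt_of_lt_one_left hTpos (hg1 w hw))

lemma hasBSProp_zero : HasBSProp 𝕂 (0 : C₀(ℕ, 𝕂) →L[𝕂] Y) := by
  refine fun S _ => ⟨c0Basis 𝕂 0, le_antisymm (c0_norm_le zero_le_one fun n => ?_) ?_, ?_, ?_⟩
  · rw [c0Basis_apply]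
    split_ifs <;> simp
  · simpa [c0Basis_apply] using c0_norm_apply_le (c0Basis 𝕂 0) 0
  · simp
  · intro a
    simp

end

open scoped ZeroAtInfty in
/-- If `Y` contains no subspace isomorphic to `c₀`, then the zero operator is the only
operator from `c₀` to `Y` with the Bhatia--Šemrl property. -/
theorem BS_eq_zero_of_no_c0_subspace {𝕂 Y : Type*} [RCLike 𝕂]
    [NormedAddCommGroup Y] [NormedSpace 𝕂 Y] [CompleteSpace Y]
    (hY : ¬ ∃ f : C₀(ℕ, 𝕂) →L[𝕂] Y, ∃ c : ℝ, 0 < c ∧ ∀ x, c * ‖x‖ ≤ ‖f x‖) :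
    {T : C₀(ℕ, 𝕂) →L[𝕂] Y | HasBSProp 𝕂 T} = {0} := by
  ext T
  refine ⟨fun hT => ?_, ?_⟩
  · by_contra h
    exact not_hasBSProp_of_ne_zero hY h hT
  · rintro rfl
    exact hasBSProp_zero
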